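/- For every integer n ≥ 2, Σ_{ν=1}^{n−1} C_n(ν)·ln Γ(ν/n) = −(γ + ln(2πn))·S_n/2 − (1/2)·Σ_{ν=1}^{n−1} Ψ(ν/n)·csc(πν/n). -/

import Mathlib

open Real Finset

/-- `C n ν = Σ_{l=1}^{n-1} cos(2πνl/n) · csc(πl/n)`. -/
noncomputable def C (n : ℕ) (ν : ℤ) : ℝ :=
  ∑ l ∈ Finset.Icc 1 (n - 1), Real.cos (2 * π * ν * l / n) / Real.sin (π * l / n)

/-- Watson's sum `S n = Σ_{l=1}^{n-1} csc(πl/n)`. -/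
noncomputable def S (n : ℕ) : ℝ :=
  ∑ l ∈ Finset.Icc 1 (n - 1), 1 / Real.sin (π * l / n)

/-- The digamma function `Ψ = Γ'/Γ`. -/
noncomputable def digamma (x : ℝ) : ℝ := deriv Real.Gamma x / Real.Gamma x

open Filter Topology

theorem tendsto_log_sub_sum_digamma {x : ℝ} (hx : 0 < x) :
    Tendsto (fun N : ℕ ↦ Real.log N - ∑ k ∈ range N, 1 / (x + k)) atTop (𝓝 (digamma x)) := by
  let f := Real.log ∘ Real.Gamma
  have hc : ConvexOn ℝ (Set.Ioi 0) f := Real.convexOn_log_Gamma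
  have h_rec (y : ℝ) (hy : 0 < y) : f (y + 1) = f y + Real.log y := by
    simp only [f, Function.comp_apply, Real.Gamma_add_one hy.ne',
      Real.log_mul hy.ne' (Real.Gamma_pos_of_pos hy).ne', add_comm]
  have hder {y : ℝ} (hy : 0 < y) : DifferentiableAt ℝ f y := by
    refine ((Real.differentiableAt_Gamma ?_).log (Real.Gamma_ne_zero ?_)) <;>
    exact fun m ↦ ne_of_gt (by linarith [(Nat.cast_nonneg m : (0 : ℝ) ≤ m)])
  have hder_rec (y : ℝ) (hy : 0 < y) : deriv f (y + 1) = deriv f y + 1 / y := by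
    rw [← deriv_comp_add_const, one_div, ← Real.deriv_log,
      ← deriv_add (hder <| by positivity) (Real.differentiableAt_log hy.ne')]
    apply EventuallyEq.deriv_eq
    filter_upwards [eventually_gt_nhds hy] using h_rec
  have hder_nat (N : ℕ) : deriv f (x + N) = deriv f x + ∑ k ∈ range N, 1 / (x + k) := by
    induction N with
    | zero => simp
    | succ N ih =>
      rw [sum_range_succ, ← add_assoc, ← ih, ← hder_rec _ (by positivity)]
      push_cast
      ring_nf
  have hdig : deriv f x = digamma x := by
    have : f = fun y ↦ Real.log (Real.Gamma y) := rfl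
    rw [digamma, this, deriv.log _ (Real.Gamma_pos_of_pos hx).ne']
    exact Real.differentiableAt_Gamma fun m ↦ by
      have : (0 : ℝ) ≤ m := Nat.cast_nonneg m
      linarith
  have hLB (y : ℝ) (hy : 0 < y) : Real.log y ≤ deriv f (y + 1) := by
    refine (le_of_eq ?_).trans <| hc.slope_le_deriv (Set.mem_Ioi.mpr hy)
      (Set.mem_Ioi.mpr (by positivity : 0 < y + 1)) (by linarith) (hder <| by positivity)
    rw [slope_def_field, h_rec y hy]
    simp
  have hUB (y : ℝ) (hy : 0 < y) : deriv f y ≤ Real.log y := by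
    refine (hc.deriv_le_slope (Set.mem_Ioi.mpr hy)
      (Set.mem_Ioi.mpr (by positivity : 0 < y + 1)) (by linarith) (hder hy)).trans (le_of_eq ?_)
    rw [slope_def_field, h_rec y hy]
    simp
  have hlim (c : ℝ) : Tendsto (fun N : ℕ ↦ digamma x - (Real.log (N + c) - Real.log N)) atTop
      (𝓝 (digamma x)) := by
    simpa using tendsto_const_nhds.sub
      ((Real.tendsto_log_comp_add_sub_log c).comp tendsto_natCast_atTop_atTop)
  refine tendsto_of_tendsto_of_tendsto_of_le_of_le' (hlim x) (hlim (x - 1)) ?_ ?_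
  · filter_upwards with N
    have := hUB (x + N) (by positivity)
    rw [hder_nat, hdig, add_comm x] at this
    linarith
  · filter_upwards [eventually_ge_atTop 1] with N hN
    have hN' : (1 : ℝ) ≤ N := by exact_mod_cast hN
    have := hLB (N + (x - 1)) (by linarith)
    rw [show (N : ℝ) + (x - 1) + 1 = x + N by ring, hder_nat, hdig] at this
    linarith

theorem Complex.tendsto_sum_pow_div_neg_log {z : ℂ} (hz : ‖z‖ = 1) (hz1 : z ≠ 1) :
    Tendsto (fun N : ℕ ↦ ∑ m ∈ range N, z ^ (m + 1) / (m + 1)) atTop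
      (𝓝 (-Complex.log (1 - z))) := by
  have hsub : z - 1 ≠ 0 := sub_ne_zero.mpr hz1
  have hanti : Antitone (fun m : ℕ ↦ (1 : ℝ) / (m + 1)) := fun a b hab ↦ by
    have : (a : ℝ) ≤ b := by exact_mod_cast hab
    dsimp only
    gcongr
  have hbound (N : ℕ) : ‖∑ m ∈ range N, z ^ (m + 1)‖ ≤ 2 / ‖z - 1‖ := by
    simp_rw [pow_succ, ← sum_mul]
    rw [geom_sum_eq hz1, norm_mul, hz, mul_one, norm_div]
    gcongr
    refine (norm_sub_le _ _).trans ?_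
    rw [norm_pow, hz]
    norm_num
  obtain ⟨l, hl⟩ := cauchySeq_tendsto_of_complete
    (hanti.cauchySeq_series_mul_of_tendsto_zero_of_bounded
      tendsto_one_div_add_atTop_nhds_zero_nat hbound)
  have hl' : Tendsto (fun N : ℕ ↦ ∑ m ∈ range N, z ^ (m + 1) / (m + 1)) atTop (𝓝 l) := by
    refine hl.congr fun N ↦ sum_congr rfl fun m _ ↦ ?_
    rw [Complex.real_smul]
    push_cast
    ring
  have habel := Complex.tendsto_tsum_powerSeries_nhdsWithin_lt hl'
  rw [tendsto_map'_iff] at habel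
  have hslit : (1 - z) ∈ Complex.slitPlane := by
    rw [Complex.mem_slitPlane_iff]
    by_contra! h
    have hre : 1 ≤ z.re := by simpa using h.1
    have him : z.im = 0 := by simpa using h.2
    have h2 := Complex.re_le_norm z
    exact hz1 (Complex.ext (by simp; linarith) (by simpa using him))
  have hcont : Tendsto (fun r : ℝ ↦ -Complex.log (1 - r * z)) (𝓝[<] 1)
      (𝓝 (-Complex.log (1 - z))) := by
    have : ContinuousAt (fun r : ℝ ↦ -Complex.log (1 - r * z)) 1 := by
      refine ContinuousAt.neg (ContinuousAt.clog (by fun_prop) (by simpa using hslit))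
    simpa using this.tendsto.mono_left nhdsWithin_le_nhds
  have heq : ∀ᶠ r : ℝ in 𝓝[<] 1,
      (r : ℂ) * ∑' m : ℕ, z ^ (m + 1) / (m + 1) * (r : ℂ) ^ m = -Complex.log (1 - r * z) := by
    filter_upwards [Ioo_mem_nhdsLT (show (0 : ℝ) < 1 by norm_num)] with r hr
    have hn : ‖(r : ℂ) * z‖ < 1 := by
      rw [norm_mul, hz, mul_one, Complex.norm_real, Real.norm_of_nonneg hr.1.le]
      exact hr.2
    rw [← (Complex.hasSum_taylorSeries_neg_log' hn).tsum_eq, ← tsum_mul_left]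
    refine tsum_congr fun m ↦ ?_
    rw [mul_pow]
    ring
  have hr : Tendsto (fun r : ℝ ↦ (r : ℂ)) (𝓝[<] 1) (𝓝 1) := by
    have : ContinuousAt (fun r : ℝ ↦ (r : ℂ)) 1 := by fun_prop
    simpa using this.tendsto.mono_left nhdsWithin_le_nhds
  have hlim := (hr.mul habel).congr' heq
  rw [one_mul] at hlim
  rwa [tendsto_nhds_unique hcont hlim]

theorem tendsto_sum_cos_div_neg_log {θ : ℝ} (h : 0 < Real.sin (θ / 2)) :
    Tendsto (fun N : ℕ ↦ ∑ m ∈ range N, Real.cos ((m + 1) * θ) / (m + 1)) atTop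
      (𝓝 (-Real.log (2 * Real.sin (θ / 2)))) := by
  have hnorm : ‖Complex.exp (Complex.I * θ) - 1‖ = 2 * Real.sin (θ / 2) := by
    rw [Complex.norm_exp_I_mul_ofReal_sub_one, Real.norm_of_nonneg (by positivity)]
  have h1 : Complex.exp (Complex.I * θ) ≠ 1 := by
    rw [← sub_ne_zero, ← norm_pos_iff, hnorm]
    positivity
  have := (Complex.continuous_re.tendsto _).comp
    (Complex.tendsto_sum_pow_div_neg_log (Complex.norm_exp_I_mul_ofReal θ) h1)
  rw [Complex.neg_re, Complex.log_re, norm_sub_rev, hnorm] at this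
  refine this.congr fun N ↦ ?_
  rw [Function.comp_apply, Complex.re_sum]
  refine sum_congr rfl fun m _ ↦ ?_
  rw [← Complex.exp_nat_mul, show (((m + 1 : ℕ) : ℂ) * (Complex.I * θ)) =
    (((m + 1) * θ : ℝ) : ℂ) * Complex.I by push_cast; ring,
    show ((m : ℂ) + 1) = ((m + 1 : ℝ) : ℂ) by push_cast; rfl, Complex.div_ofReal_re,
    Complex.exp_ofReal_mul_I_re]

theorem sum_range_cos_two_pi_mul_div {n : ℕ} (hn : n ≠ 0) (k : ℤ) :
    ∑ l ∈ range n, Real.cos (2 * π * k * l / n) = if (n : ℤ) ∣ k then (n : ℝ) else 0 := by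
  have hn' : (n : ℝ) ≠ 0 := by exact_mod_cast hn
  have hnC : (n : ℂ) ≠ 0 := by exact_mod_cast hn
  split_ifs with h
  · obtain ⟨q, rfl⟩ := h
    have (l : ℕ) : Real.cos (2 * π * ((n * q : ℤ) : ℝ) * l / n) = 1 := by
      rw [Real.cos_eq_one_iff]
      exact ⟨q * l, by push_cast; field_simp⟩
    simp only [this]
    simp
  · set z := Complex.exp (2 * π * Complex.I * (k / n)) with hz
    have hz1 : z ≠ 1 := by
      intro h1
      obtain ⟨q, hq⟩ := Complex.exp_eq_one_iff.mp h1
      refine h ⟨q, ?_⟩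
      have h2 : (k : ℂ) / n = q := by
        have := Complex.two_pi_I_ne_zero
        apply mul_left_cancel₀ this
        rw [hq]; ring
      rw [div_eq_iff hnC] at h2
      have : k = q * n := by exact_mod_cast h2
      rw [this, mul_comm]
    have hzn : z ^ n = 1 := by
      rw [hz, ← Complex.exp_nat_mul, Complex.exp_eq_one_iff]
      exact ⟨k, by field_simp⟩
    have hsum : ∑ l ∈ range n, z ^ l = 0 := by rw [geom_sum_eq hz1, hzn]; simp
    have hre := congrArg Complex.re hsum
    rw [Complex.re_sum, Complex.zero_re] at hre
    rw [← hre]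
    refine sum_congr rfl fun l _ ↦ ?_
    rw [hz, ← Complex.exp_nat_mul, show ((l : ℂ) * (2 * π * Complex.I * (k / n))) =
      ((2 * π * k * l / n : ℝ) : ℂ) * Complex.I by push_cast; ring, Complex.exp_ofReal_mul_I_re]

theorem sum_range_mul_eq_sum_sum {M : Type*} [AddCommMonoid M] (f : ℕ → M) (n N : ℕ) :
    ∑ m ∈ range (n * N), f m = ∑ j ∈ range n, ∑ k ∈ range N, f (n * k + j) := by
  rw [sum_comm]
  induction N with
  | zero => simp
  | succ N ih => rw [Nat.mul_succ, sum_range_add, ih, sum_range_succ]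

/-- The cosine transform of the digamma values at `1/n, …, n/n`, as a limit of partial sums. -/
theorem tendsto_sum_digamma_mul_cos {n : ℕ} (hn : n ≠ 0) (l : ℕ) :
    Tendsto (fun N : ℕ ↦ Real.log N * (∑ j ∈ range n, Real.cos ((j + 1) * (2 * π * l / n)))
        - n * ∑ m ∈ range (n * N), Real.cos ((m + 1) * (2 * π * l / n)) / (m + 1)) atTop
      (𝓝 (∑ j ∈ range n, digamma ((j + 1) / n) * Real.cos ((j + 1) * (2 * π * l / n)))) := by
  have hn' : (n : ℝ) ≠ 0 := by exact_mod_cast hn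
  have := tendsto_finsetSum (range n) fun j _ ↦
    (tendsto_log_sub_sum_digamma (show (0 : ℝ) < (j + 1) / n by positivity)).mul_const
      (Real.cos ((j + 1) * (2 * π * l / n)))
  refine this.congr fun N ↦ ?_
  rw [sum_range_mul_eq_sum_sum, mul_sum, mul_sum, ← sum_sub_distrib]
  refine sum_congr rfl fun j _ ↦ ?_
  rw [sub_mul, mul_sum, sum_mul]
  congr 1
  refine sum_congr rfl fun k _ ↦ ?_
  have hcos : Real.cos ((((n * k + j : ℕ) : ℝ) + 1) * (2 * π * l / n)) =
      Real.cos ((j + 1) * (2 * π * l / n)) := by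
    rw [← Real.cos_add_nat_mul_two_pi ((j + 1) * (2 * π * l / n)) (k * l)]
    congr 1
    push_cast
    field_simp
    ring
  have : (j : ℝ) + 1 + n * k ≠ 0 := by positivity
  rw [hcos]
  push_cast
  rw [show ((j : ℝ) + 1) / n + k = (j + 1 + n * k) / n by field_simp,
    show (n : ℝ) * k + j + 1 = j + 1 + n * k by ring]
  field_simp

theorem sum_digamma_div {n : ℕ} (hn : n ≠ 0) :
    ∑ j ∈ range n, digamma ((j + 1) / n)
      = -(n * (Real.eulerMascheroniConstant + Real.log n)) := by
  have hn' : (n : ℝ) ≠ 0 := by exact_mod_cast hn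
  have h1 := tendsto_sum_digamma_mul_cos hn 0
  have h2 := (Real.tendsto_harmonic_sub_log.comp
    (tendsto_id.const_mul_atTop' (Nat.pos_of_ne_zero hn))).const_mul (-(n : ℝ))
    |>.sub_const (n * Real.log n)
  simp only [CharP.cast_eq_zero, mul_zero, zero_div, Real.cos_zero, mul_one] at h1
  rw [tendsto_nhds_unique h1 (h2.congr' ?_)]
  · ring
  · filter_upwards [eventually_ne_atTop 0] with N hN
    have hN' : (N : ℝ) ≠ 0 := by exact_mod_cast hN
    simp only [Function.comp_apply, id, harmonic]
    push_cast
    rw [Real.log_mul hn' hN']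
    simp
    ring

theorem sin_pi_mul_div_pos {n l : ℕ} (hl : 0 < l) (hln : l < n) :
    0 < Real.sin (π * l / n) := by
  have hl' : (0 : ℝ) < l := by exact_mod_cast hl
  have hln' : (l : ℝ) < n := by exact_mod_cast hln
  have hn0 : (0 : ℝ) < n := hl'.trans hln'
  apply Real.sin_pos_of_pos_of_lt_pi (by positivity)
  rw [div_lt_iff₀ hn0]
  gcongr

theorem sum_digamma_mul_cos {n l : ℕ} (hl : 0 < l) (hln : l < n) :
    ∑ j ∈ range n, digamma ((j + 1) / n) * Real.cos ((j + 1) * (2 * π * l / n))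
      = n * Real.log (2 * Real.sin (π * l / n)) := by
  have hn : n ≠ 0 := by omega
  have hn' : (n : ℝ) ≠ 0 := by exact_mod_cast hn
  have hsin := sin_pi_mul_div_pos hl hln
  have hhalf : 2 * π * l / n / 2 = π * l / n := by ring
  have hcos : ∑ j ∈ range n, Real.cos ((j + 1) * (2 * π * l / n)) = 0 := by
    have h0 := sum_range_cos_two_pi_mul_div hn l
    rw [if_neg (by
      rw [Int.natCast_dvd_natCast]
      exact Nat.not_dvd_of_pos_of_lt hl hln)] at h0
    have h1 := sum_range_succ' (fun j : ℕ ↦ Real.cos (j * (2 * π * l / n))) n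
    rw [sum_range_succ] at h1
    have h2 : Real.cos (n * (2 * π * l / n)) = 1 := by
      rw [Real.cos_eq_one_iff]
      exact ⟨l, by push_cast; field_simp⟩
    rw [h2] at h1
    simp only [Nat.cast_add, Nat.cast_one, CharP.cast_eq_zero, zero_mul, Real.cos_zero,
      add_left_inj] at h1
    rw [← h1, ← h0]
    refine sum_congr rfl fun j _ ↦ ?_
    congr 1
    push_cast
    ring
  have h1 := tendsto_sum_digamma_mul_cos hn l
  simp only [hcos, mul_zero, zero_sub] at h1
  have h2 := ((tendsto_sum_cos_div_neg_log (hhalf.symm ▸ hsin)).comp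
    (tendsto_id.const_mul_atTop' (Nat.pos_of_ne_zero hn))).const_mul (n : ℝ) |>.neg
  rw [tendsto_nhds_unique h1 h2, hhalf]
  ring

theorem sum_Icc_reflect (n : ℕ) (f : ℕ → ℝ) :
    ∑ l ∈ Icc 1 (n - 1), f (n - l) = ∑ l ∈ Icc 1 (n - 1), f l := by
  refine sum_nbij' (n - ·) (n - ·) ?_ ?_ ?_ ?_ fun _ _ ↦ rfl <;>
  · intro l hl
    simp only [mem_Icc] at hl ⊢
    omega

theorem sin_pi_mul_sub_div {n l : ℕ} (hn : n ≠ 0) (hln : l ≤ n) :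
    Real.sin (π * (n - l : ℕ) / n) = Real.sin (π * l / n) := by
  have hn' : (n : ℝ) ≠ 0 := by exact_mod_cast hn
  rw [← Real.sin_pi_sub]
  congr 1
  push_cast [hln]
  field_simp
  ring

theorem C_sub {n ν : ℕ} (hn : n ≠ 0) (hν : ν ≤ n) : C n ((n - ν : ℕ) : ℤ) = C n (ν : ℤ) := by
  have hn' : (n : ℝ) ≠ 0 := by exact_mod_cast hn
  unfold C
  refine sum_congr rfl fun l _ ↦ ?_
  congr 1
  rw [← Real.cos_neg, ← Real.cos_add_nat_mul_two_pi (-(2 * π * ((n - ν : ℕ) : ℤ) * l / n)) l]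
  congr 1
  push_cast [hν]
  field_simp
  ring

theorem sum_C_eq {n : ℕ} (hn : n ≠ 0) : ∑ ν ∈ Icc 1 (n - 1), C n (ν : ℤ) = -S n := by
  unfold C S
  rw [sum_comm, ← sum_neg_distrib]
  refine sum_congr rfl fun l hl ↦ ?_
  rw [← sum_div, neg_div', div_left_inj' (sin_pi_mul_div_pos (by grind) (by grind)).ne']
  have h := sum_range_cos_two_pi_mul_div hn l
  rw [if_neg (by
    rw [Int.natCast_dvd_natCast]
    exact Nat.not_dvd_of_pos_of_lt (by grind) (by grind))] at h
  rw [range_eq_Ico, sum_eq_sum_Ico_succ_bot (Nat.pos_of_ne_zero hn)] at h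
  have hI : Icc 1 (n - 1) = Ico (0 + 1) n := by grind
  rw [hI, eq_neg_iff_add_eq_zero, add_comm, ← h]
  simp only [CharP.cast_eq_zero, mul_zero, zero_div, Real.cos_zero]
  congr 1
  refine sum_congr rfl fun ν _ ↦ ?_
  congr 1
  push_cast
  ring

/-- Discrete Fourier inversion for the values of the digamma function at `1/n, …, n/n`. -/
theorem sum_cos_mul_sum_digamma_mul_cos {n ν : ℕ} (hν : 0 < ν) (hνn : ν < n) :
    ∑ l ∈ range n, Real.cos (2 * π * ν * l / n) *
        ∑ j ∈ range n, digamma ((j + 1) / n) * Real.cos ((j + 1) * (2 * π * l / n))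
      = n / 2 * (digamma (ν / n) + digamma ((n - ν : ℕ) / n)) := by
  have hn : n ≠ 0 := by omega
  simp_rw [mul_sum]
  rw [sum_comm]
  have key (j : ℕ) (hj : j ∈ range n) :
      ∑ l ∈ range n, Real.cos (2 * π * ν * l / n) *
        (digamma ((j + 1) / n) * Real.cos ((j + 1) * (2 * π * l / n)))
      = (if j = ν - 1 then n / 2 * digamma ((j + 1) / n) else 0) +
        (if j = n - ν - 1 then n / 2 * digamma ((j + 1) / n) else 0) := by
    rw [mem_range] at hj
    have hsub := sum_range_cos_two_pi_mul_div hn ((ν : ℤ) - (j + 1))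
    have hadd := sum_range_cos_two_pi_mul_div hn ((ν : ℤ) + (j + 1))
    have hsub_iff : (n : ℤ) ∣ (ν : ℤ) - (j + 1) ↔ j = ν - 1 := by
      constructor
      · intro h
        have := Int.eq_zero_of_abs_lt_dvd h (by rw [abs_lt]; omega)
        omega
      · rintro rfl
        exact ⟨0, by omega⟩
    have hadd_iff : (n : ℤ) ∣ (ν : ℤ) + (j + 1) ↔ j = n - ν - 1 := by
      constructor
      · intro h
        have := Int.eq_zero_of_abs_lt_dvd (h.sub (dvd_refl _)) (by rw [abs_lt]; omega)
        omega
      · rintro rfl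
        exact ⟨1, by omega⟩
    simp only [hsub_iff] at hsub
    simp only [hadd_iff] at hadd
    calc _ = digamma ((j + 1) / n) / 2 *
          (∑ l ∈ range n, Real.cos (2 * π * ((ν : ℤ) - (j + 1) : ℤ) * l / n) +
            ∑ l ∈ range n, Real.cos (2 * π * ((ν : ℤ) + (j + 1) : ℤ) * l / n)) := by
          rw [← sum_add_distrib, mul_sum]
          refine sum_congr rfl fun l _ ↦ ?_
          have h1 : 2 * π * (((ν : ℤ) - (j + 1) : ℤ) : ℝ) * l / n =
            2 * π * ν * l / n - (j + 1) * (2 * π * l / n) := by push_cast; ring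
          have h2 : 2 * π * (((ν : ℤ) + (j + 1) : ℤ) : ℝ) * l / n =
            2 * π * ν * l / n + (j + 1) * (2 * π * l / n) := by push_cast; ring
          rw [h1, h2, Real.cos_sub, Real.cos_add]
          ring
      _ = _ := by
          rw [hsub, hadd]
          split_ifs <;> ring
  rw [sum_congr rfl key, sum_add_distrib, sum_ite_eq', sum_ite_eq',
    if_pos (by rw [mem_range]; omega), if_pos (by rw [mem_range]; omega), mul_add]
  have h1 : ((ν - 1 : ℕ) : ℝ) + 1 = ν := by
    exact_mod_cast Nat.sub_add_cancel hν
  have h2 : ((n - ν - 1 : ℕ) : ℝ) + 1 = (n - ν : ℕ) := by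
    exact_mod_cast Nat.sub_add_cancel (show 1 ≤ n - ν by omega)
  rw [h1, h2]

theorem sum_C_mul_log_sin {n : ℕ} (hn : n ≠ 0) :
    ∑ l ∈ Icc 1 (n - 1), C n (l : ℤ) * Real.log (Real.sin (π * l / n))
      = ∑ ν ∈ Icc 1 (n - 1), digamma (ν / n) * (1 / Real.sin (π * ν / n))
        + (Real.eulerMascheroniConstant + Real.log (2 * n)) * S n := by
  have hn' : (n : ℝ) ≠ 0 := by exact_mod_cast hn
  set D : ℕ → ℝ := fun l ↦
    ∑ j ∈ range n, digamma ((j + 1) / n) * Real.cos ((j + 1) * (2 * π * l / n)) with hD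
  have hinv : ∑ l ∈ range n, C n (l : ℤ) * D l
      = n * ∑ ν ∈ Icc 1 (n - 1), digamma (ν / n) * (1 / Real.sin (π * ν / n)) := by
    calc _ = ∑ ν ∈ Icc 1 (n - 1), (1 / Real.sin (π * ν / n)) *
          ∑ l ∈ range n, Real.cos (2 * π * ν * l / n) * D l := by
          simp_rw [C, sum_mul, mul_sum]
          rw [sum_comm]
          refine sum_congr rfl fun ν _ ↦ sum_congr rfl fun l _ ↦ ?_
          rw [Int.cast_natCast, show 2 * π * (l : ℝ) * ν = 2 * π * ν * l by ring]
          ring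
      _ = n / 2 * (∑ ν ∈ Icc 1 (n - 1), digamma (ν / n) * (1 / Real.sin (π * ν / n)) +
          ∑ ν ∈ Icc 1 (n - 1),
            digamma ((n - ν : ℕ) / n) * (1 / Real.sin (π * (n - ν : ℕ) / n))) := by
          rw [← sum_add_distrib, mul_sum]
          refine sum_congr rfl fun ν hν ↦ ?_
          rw [hD, sum_cos_mul_sum_digamma_mul_cos (by grind) (by grind),
            sin_pi_mul_sub_div hn (by grind)]
          ring
      _ = _ := by
          rw [sum_Icc_reflect n fun ν ↦ digamma (ν / n) * (1 / Real.sin (π * ν / n))]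
          ring
  have hI : Icc 1 (n - 1) = Ico (0 + 1) n := by grind
  have hC0 : C n ((0 : ℕ) : ℤ) = S n := by simp [C, S]
  have hD0 : D 0 = -(n * (Real.eulerMascheroniConstant + Real.log n)) := by
    rw [← sum_digamma_div hn]
    simp [hD]
  have hDl : ∑ l ∈ Icc 1 (n - 1), C n (l : ℤ) * D l
      = n * (∑ l ∈ Icc 1 (n - 1), C n (l : ℤ) * Real.log (Real.sin (π * l / n))
        - Real.log 2 * S n) := by
    rw [sub_eq_add_neg, ← mul_neg, ← sum_C_eq hn, mul_sum (a := Real.log 2), ← sum_add_distrib,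
      mul_sum]
    refine sum_congr rfl fun l hl ↦ ?_
    rw [hD]
    beta_reduce
    rw [sum_digamma_mul_cos (by grind) (by grind),
      Real.log_mul two_ne_zero (sin_pi_mul_div_pos (by grind) (by grind)).ne']
    ring
  rw [range_eq_Ico, sum_eq_sum_Ico_succ_bot (Nat.pos_of_ne_zero hn), ← hI, hC0, hD0, hDl] at hinv
  rw [Real.log_mul two_ne_zero hn']
  apply mul_left_cancel₀ hn'
  linear_combination hinv

theorem log_Gamma_add_log_Gamma_sub {n ν : ℕ} (hν : 0 < ν) (hνn : ν < n) :
    Real.log (Real.Gamma ((ν : ℝ) / n)) + Real.log (Real.Gamma ((n - ν : ℕ) / n))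
      = Real.log π - Real.log (Real.sin (π * ν / n)) := by
  have hν' : (0 : ℝ) < ν := by exact_mod_cast hν
  have hνn' : (ν : ℝ) < n := by exact_mod_cast hνn
  have hn : (0 : ℝ) < n := hν'.trans hνn'
  have h1 : 1 - (ν : ℝ) / n = (n - ν : ℕ) / n := by
    push_cast [hνn.le]
    field_simp
  have hsub : (0 : ℝ) < (n - ν : ℕ) := by exact_mod_cast Nat.sub_pos_of_lt hνn
  rw [← Real.log_mul (Real.Gamma_pos_of_pos (by positivity)).ne'
    (Real.Gamma_pos_of_pos (by positivity)).ne', ← h1, Real.Gamma_mul_Gamma_one_sub,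
    ← mul_div_assoc, Real.log_div Real.pi_ne_zero (sin_pi_mul_div_pos hν hνn).ne']

theorem sum_C_logGamma (n : ℕ) (hn : 2 ≤ n) :
    ∑ ν ∈ Finset.Icc 1 (n - 1), C n (ν : ℤ) * Real.log (Real.Gamma ((ν : ℝ) / n))
      = -((Real.eulerMascheroniConstant + Real.log (2 * π * n)) * S n) / 2
        - (1 / 2) * ∑ ν ∈ Finset.Icc 1 (n - 1),
            digamma ((ν : ℝ) / n) * (1 / Real.sin (π * ν / n)) := by
  have hn0 : n ≠ 0 := by omega
  have hn' : (n : ℝ) ≠ 0 := by exact_mod_cast hn0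
  have hrefl : ∑ ν ∈ Icc 1 (n - 1), C n (ν : ℤ) * Real.log (Real.Gamma ((n - ν : ℕ) / n))
      = ∑ ν ∈ Icc 1 (n - 1), C n (ν : ℤ) * Real.log (Real.Gamma ((ν : ℝ) / n)) := by
    rw [← sum_Icc_reflect n fun ν ↦ C n (ν : ℤ) * Real.log (Real.Gamma ((ν : ℝ) / n))]
    refine sum_congr rfl fun ν hν ↦ ?_
    rw [C_sub hn0 (by grind)]
  have htwice : 2 * ∑ ν ∈ Icc 1 (n - 1), C n (ν : ℤ) * Real.log (Real.Gamma ((ν : ℝ) / n))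
      = -(Real.log π * S n)
        - ∑ ν ∈ Icc 1 (n - 1), C n (ν : ℤ) * Real.log (Real.sin (π * ν / n)) := by
    rw [two_mul]
    nth_rw 2 [← hrefl]
    rw [← mul_neg, ← sum_C_eq hn0, mul_sum, ← sum_add_distrib, ← sum_sub_distrib]
    refine sum_congr rfl fun ν hν ↦ ?_
    rw [← mul_add, log_Gamma_add_log_Gamma_sub (by grind) (by grind)]
    ring
  rw [sum_C_mul_log_sin hn0, Real.log_mul two_ne_zero hn'] at htwice
  rw [Real.log_mul (by positivity) hn', Real.log_mul two_ne_zero Real.pi_ne_zero]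
  linear_combination htwice / 2
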